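/- Let 0 < r ≤ 1 and let 𝔟 denote the Bergman kernel 𝔟(z,w) = (1 − z·conj(w))^{−2} restricted to the disc r𝔻 = {z ∈ ℂ : |z| < r}. Let ℓ be a positive kernel on r𝔻 of the form ℓ(z,w) = Σ_{i,j≥0} ℓ_{ij}·z^i·conj(w)^j, the double series converging absolutely for all z, w ∈ r𝔻, and assume ℓ is regular: (i) there exists ε > 0 such that for every n and all distinct points z₁,…,zₙ in the disc {|z| < ε} the functions x ↦ ℓ(x,z₁),…, x ↦ ℓ(x,zₙ) on r𝔻 are linearly independent; and (ii) for every n ≥ 0 the determinant of the matrix (ℓ_{ij})_{0≤i,j≤n} is nonzero. If (𝔟, ℓ) is a complete Pick pair on r𝔻, then r ≤ 1/√2. -/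

import Mathlib

open Matrix
open scoped ComplexOrder

noncomputable section

/-- `k` is a positive (semi-definite) kernel on `X`: every Gram sum is a nonnegative real
(using the partial order on `ℂ`, so `0 ≤ w` means `w` is real and nonnegative). -/
def IsPosKernel {X : Type*} (k : X → X → ℂ) : Prop :=
  ∀ (n : ℕ) (z : Fin n → X) (c : Fin n → ℂ),
    0 ≤ ∑ i, ∑ j, (starRingEnd ℂ) (c i) * c j * k (z i) (z j)

/-- Positive semidefiniteness of the block matrix `[ℓ(z i, z j)·I − k(z i, z j)·W i (W j)ᴴ]`. -/
def PickBlockPSD {X : Type*} (k ℓ : X → X → ℂ) {n N : ℕ}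
    (z : Fin n → X) (W : Fin n → Matrix (Fin N) (Fin N) ℂ) : Prop :=
  ∀ u : Fin n → (Fin N → ℂ),
    0 ≤ ∑ i, ∑ j,
      star (u i) ⬝ᵥ ((ℓ (z i) (z j) • (1 : Matrix (Fin N) (Fin N) ℂ)
        - k (z i) (z j) • (W i * (W j)ᴴ)) *ᵥ u j)

/-- `Φ` is a contractive multiplier from `k` to `ℓ`. -/
def IsContractiveMultiplier {X : Type*} (k ℓ : X → X → ℂ) {N : ℕ}
    (Φ : X → Matrix (Fin N) (Fin N) ℂ) : Prop :=
  ∀ (n : ℕ) (z : Fin n → X), PickBlockPSD k ℓ z fun i => Φ (z i)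

/-- `(k, ℓ)` is a complete Pick pair. -/
def IsCompletePickPair {X : Type*} (k ℓ : X → X → ℂ) : Prop :=
  ∀ (n N : ℕ), 1 ≤ n → 1 ≤ N →
    ∀ (z : Fin n → X) (W : Fin n → Matrix (Fin N) (Fin N) ℂ),
      PickBlockPSD k ℓ z W →
      ∃ Φ : X → Matrix (Fin N) (Fin N) ℂ,
        IsContractiveMultiplier k ℓ Φ ∧ ∀ i, Φ (z i) = W i

/-- The Bergman kernel `𝔟(z,w) = (1 − z·conj w)^{−2}` of the unit disc. -/
def bergman (z w : ℂ) : ℂ := ((1 - z * (starRingEnd ℂ) w) ^ 2)⁻¹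

/-- The open disc of radius `r` about `0`, as a type. -/
abbrev Disc (r : ℝ) := {z : ℂ // ‖z‖ < r}

/-- The holomorphic kernel with double power series coefficients `ℓc`. -/
def serKer (ℓc : ℕ → ℕ → ℂ) (z w : ℂ) : ℂ :=
  ∑' p : ℕ × ℕ, ℓc p.1 p.2 * z ^ p.1 * ((starRingEnd ℂ) w) ^ p.2

lemma psd_of_form {n : ℕ} (M : Matrix (Fin n) (Fin n) ℂ)
    (h : ∀ u : Fin n → ℂ, 0 ≤ star u ⬝ᵥ (M *ᵥ u)) : M.PosSemidef := by
  refine Matrix.PosSemidef.of_dotProduct_mulVec_nonneg ?_ h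
  rw [← Matrix.isSymmetric_toEuclideanLin_iff, LinearMap.isSymmetric_iff_inner_map_self_real]
  intro v
  have h1 := h (WithLp.ofLp v)
  have h2 : inner ℂ v (Matrix.toEuclideanLin M v)
      = star (WithLp.ofLp v) ⬝ᵥ (M *ᵥ (WithLp.ofLp v)) := by
    rw [EuclideanSpace.inner_eq_star_dotProduct, dotProduct_comm]
    rfl
  rw [inner_conj_symm, h2, ← inner_conj_symm, h2]
  exact (Complex.conj_eq_iff_im.mpr (Complex.le_def.mp h1).2.symm).symm

lemma form_eq {n : ℕ} (M : Matrix (Fin n) (Fin n) ℂ) (c : Fin n → ℂ) :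
    star c ⬝ᵥ (M *ᵥ c) = ∑ i, ∑ j, (starRingEnd ℂ) (c i) * c j * M i j := by
  simp only [dotProduct, mulVec, Finset.mul_sum, Pi.star_apply]
  refine Finset.sum_congr rfl fun i _ => Finset.sum_congr rfl fun j _ => ?_
  rw [starRingEnd_apply]; ring

def kmat {X : Type*} (k : X → X → ℂ) {n : ℕ} (z : Fin n → X) : Matrix (Fin n) (Fin n) ℂ :=
  Matrix.of fun i j => k (z i) (z j)

lemma kmat_psd {X : Type*} {k : X → X → ℂ} (h : IsPosKernel k) {n : ℕ} (z : Fin n → X) :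
    (kmat k z).PosSemidef := by
  apply psd_of_form
  intro u
  rw [form_eq]
  exact h n z u

lemma pick_iff {X : Type*} (k ℓ : X → X → ℂ) {n : ℕ} (z : Fin n → X)
    (W : Fin n → Matrix (Fin 1) (Fin 1) ℂ) :
    PickBlockPSD k ℓ z W ↔
      (Matrix.of fun i j => ℓ (z i) (z j)
        - k (z i) (z j) * (W i 0 0 * (starRingEnd ℂ) (W j 0 0)) : Matrix (Fin n) (Fin n) ℂ).PosSemidef := by
  have key : ∀ u : Fin n → (Fin 1 → ℂ), (∑ i, ∑ j,
      star (u i) ⬝ᵥ ((ℓ (z i) (z j) • (1 : Matrix (Fin 1) (Fin 1) ℂ)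
        - k (z i) (z j) • (W i * (W j)ᴴ)) *ᵥ u j)) =
      ∑ i, ∑ j, (starRingEnd ℂ) (u i 0) * u j 0 * (ℓ (z i) (z j)
        - k (z i) (z j) * (W i 0 0 * (starRingEnd ℂ) (W j 0 0))) := by
    intro u
    refine Finset.sum_congr rfl fun i _ => Finset.sum_congr rfl fun j _ => ?_
    simp [dotProduct, mulVec, Matrix.mul_apply]
    ring
  constructor
  · intro h
    apply psd_of_form
    intro u
    rw [form_eq]
    have := h (fun i _ => u i)
    rw [key] at this
    exact this
  · intro h u
    rw [key]
    have := h.dotProduct_mulVec_nonneg (fun i => u i 0)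
    rw [form_eq] at this
    exact this

lemma det_sub_single {m : ℕ} (A : Matrix (Fin (m+1)) (Fin (m+1)) ℂ) (μ : ℂ) :
    (A - Matrix.single 0 0 μ).det = A.det - μ * (A.submatrix Fin.succ Fin.succ).det := by
  have h1 : A - Matrix.single 0 0 μ = A.updateRow 0 (A 0 + (-μ) • Pi.single 0 1) := by
    ext i j
    refine Fin.cases ?_ (fun i => ?_) i
    · refine Fin.cases ?_ (fun j => ?_) j
      · simp; ring
      · simp [Matrix.single, (Fin.succ_ne_zero j).symm]
    · simp [Matrix.single, Fin.succ_ne_zero, (Fin.succ_ne_zero i).symm]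
  rw [h1, det_updateRow_add, updateRow_eq_self, det_updateRow_smul, ← adjugate_apply,
    adjugate_fin_succ_eq_det_submatrix]
  simp
  ring

lemma schur_psd {m : ℕ} (P : Matrix (Fin (m+1)) (Fin (m+1)) ℂ) (hP : P.PosSemidef)
    (hd : (P.submatrix Fin.succ Fin.succ).det ≠ 0) :
    (P - Matrix.single 0 0 (P.det / (P.submatrix Fin.succ Fin.succ).det)).PosSemidef := by
  set q := (P.submatrix Fin.succ Fin.succ).det with hq
  set δ := P.det / q with hδ
  have hδ0 : 0 ≤ δ := by
    have h1 : 0 ≤ P.det := hP.det_nonneg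
    have h2 : 0 ≤ q := (hP.submatrix Fin.succ).det_nonneg
    exact div_nonneg h1 h2
  have hδr : star δ = δ := (IsSelfAdjoint.of_nonneg hδ0)
  set R := P - Matrix.single 0 0 δ with hR
  have hRh : R.IsHermitian := by
    refine hP.isHermitian.sub ?_
    rw [Matrix.IsHermitian, Matrix.conjTranspose_single, hδr]
  let v : Fin (m+1) → ℂ := fun i => P.adjugate i 0 / q
  have hv0 : v 0 = 1 := by
    simp only [v]
    rw [adjugate_fin_succ_eq_det_submatrix]
    simp [← hq, hd]
  have hPv : P *ᵥ v = Pi.single 0 δ := by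
    have h1 := congrFun (congrArg (fun M => fun i => M i 0) (Matrix.mul_adjugate P))
    ext i
    have h2 := h1 i
    simp only [Matrix.mul_apply] at h2
    simp only [mulVec, dotProduct, v]
    rw [show (∑ j, P i j * (P.adjugate j 0 / q)) = (∑ j, P i j * P.adjugate j 0) / q by
      rw [Finset.sum_div]; exact Finset.sum_congr rfl fun j _ => by ring]
    rw [h2]
    by_cases h : i = 0
    · subst h; simp [hδ]
    · simp [h]
  have hRv : R *ᵥ v = 0 := by
    rw [hR, Matrix.sub_mulVec, hPv]
    ext i
    by_cases h : i = 0
    · subst h; simp [mulVec, dotProduct, Matrix.single, hv0, Finset.sum_ite_eq]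
    · simp [h, mulVec, dotProduct, Matrix.single, Ne.symm h]
  apply psd_of_form
  intro u
  let u' : Fin (m+1) → ℂ := u - u 0 • v
  have hu' : u' 0 = 0 := by simp [u', hv0]
  have hu : u = u' + u 0 • v := by simp [u']
  have h1 : R *ᵥ u = R *ᵥ u' := by
    conv_lhs => rw [hu]
    rw [Matrix.mulVec_add, Matrix.mulVec_smul, hRv]; simp
  have h2 : star v ᵥ* R = 0 := by
    have := congrArg star hRv
    rw [Matrix.star_mulVec, hRh.eq] at this
    simpa using this
  have h3 : star u ⬝ᵥ (R *ᵥ u) = star u' ⬝ᵥ (P *ᵥ u') := by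
    rw [h1]
    conv_lhs => rw [hu]
    rw [star_add, add_dotProduct, star_smul, smul_dotProduct, Matrix.dotProduct_mulVec (star v), h2]
    rw [hR, Matrix.sub_mulVec, dotProduct_sub]
    have : (Matrix.single 0 0 δ : Matrix (Fin (m+1)) (Fin (m+1)) ℂ) *ᵥ u' = 0 := by
      ext i
      by_cases h : i = 0
      · subst h; simp [mulVec, dotProduct, Matrix.single, hu']
      · simp [mulVec, dotProduct, Matrix.single, Ne.symm h]
    rw [this]; simp
  rw [h3]
  exact hP.dotProduct_mulVec_nonneg u'

lemma bergman_self (b : ℂ) : bergman b b = ((((1 - ‖b‖^2)^2)⁻¹ : ℝ) : ℂ) := by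
  unfold bergman
  rw [Complex.mul_conj, Complex.normSq_eq_norm_sq]
  push_cast
  rfl

lemma det_ineq {r : ℝ} (hr1 : r ≤ 1) (ℓ : Disc r → Disc r → ℂ)
    (hpos : IsPosKernel ℓ)
    (hCP : IsCompletePickPair (fun z w : Disc r => bergman ↑z ↑w) ℓ)
    (a b : Disc r) (ha : (a : ℂ) = 0) {n : ℕ} (z : Fin n → Disc r)
    (hd : (kmat ℓ z).det ≠ 0) :
    ((1 - (1 - ‖(b : ℂ)‖^2)^2 : ℝ) : ℂ) *
      ((kmat ℓ (Fin.cons b z : Fin (n+1) → Disc r)).det * (kmat ℓ (Fin.cons a z : Fin (n+1) → Disc r)).det)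
      ≤ (kmat ℓ (Fin.cons b (Fin.cons a z : Fin (n+1) → Disc r) : Fin (n+2) → Disc r)).det * (kmat ℓ z).det := by
  set P := kmat ℓ (Fin.cons b z : Fin (n+1) → Disc r) with hP
  have hPp : P.PosSemidef := kmat_psd hpos _
  have hsub : P.submatrix Fin.succ Fin.succ = kmat ℓ z := by
    ext i j; simp [hP, kmat]
  have hS := schur_psd P hPp (by rw [hsub]; exact hd)
  rw [hsub] at hS
  set q := (kmat ℓ z).det with hq
  have hq0 : 0 ≤ q := (kmat_psd hpos z).det_nonneg
  have hδ0 : 0 ≤ P.det / q := div_nonneg hPp.det_nonneg hq0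
  obtain ⟨d, hd0, hdd⟩ : ∃ d : ℝ, 0 ≤ d ∧ P.det / q = (d : ℂ) := by
    refine ⟨(P.det / q).re, (Complex.le_def.mp hδ0).1, ?_⟩
    apply Complex.ext
    · simp
    · simpa using (Complex.le_def.mp hδ0).2.symm
  rw [hdd] at hS
  set s : ℝ := (1 - ‖(b:ℂ)‖^2)^2 with hs
  have hb1 : ‖(b:ℂ)‖ < 1 := lt_of_lt_of_le b.2 hr1
  have hs0 : 0 < s := by
    have : 0 < 1 - ‖(b:ℂ)‖^2 := by nlinarith [norm_nonneg (b:ℂ)]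
    positivity
  set w : ℝ := Real.sqrt (d * s) with hw
  have hww : w * w = d * s := Real.mul_self_sqrt (by positivity)
  have hwwC : (w : ℂ) * w = d * s := by exact_mod_cast hww
  let W : Fin (n+1) → Matrix (Fin 1) (Fin 1) ℂ := Fin.cons (Matrix.of fun _ _ => (w:ℂ)) (fun _ => 0)
  have hkb := bergman_self (b : ℂ)
  rw [← hs] at hkb
  have hsC : (s : ℂ) ≠ 0 := by exact_mod_cast hs0.ne'
  obtain ⟨Φ, hΦ, hΦW⟩ := hCP (n+1) 1 (by omega) le_rfl (Fin.cons b z) W (by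
    rw [pick_iff]
    convert hS using 1
    ext i j
    refine Fin.cases ?_ (fun i => ?_) i
    · refine Fin.cases ?_ (fun j => ?_) j
      · simp [W, hP, kmat, hkb, hwwC]
        field_simp
      · simp [W, hP, kmat, Matrix.single, (Fin.succ_ne_zero j).symm]
    · simp [W, hP, kmat, Matrix.single, (Fin.succ_ne_zero i).symm])
  have hb : Φ b 0 0 = w := by
    have := hΦW 0
    simp only [Fin.cons_zero, W] at this
    rw [this]; rfl
  have hz : ∀ i, Φ (z i) 0 0 = 0 := by
    intro i
    have := hΦW i.succ
    simp only [Fin.cons_succ, W] at this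
    rw [this]; rfl
  set y : Fin (n+2) → Disc r := Fin.cons b (Fin.cons a z : Fin (n+1) → Disc r) with hy
  have hM := (pick_iff _ _ _ _).mp (hΦ (n+2) y)
  have hG := Matrix.posSemidef_vecMulVec_self_star (fun i => Φ (y i) 0 0)
  have hT := hM.add hG
  have hE : (kmat ℓ y - Matrix.single 0 0 ((d * (1 - s) : ℝ) : ℂ)).PosSemidef := by
    convert hT using 1
    ext i j
    simp only [Matrix.sub_apply, Matrix.add_apply, Matrix.of_apply, Matrix.vecMulVec_apply, kmat,
      Pi.star_apply]
    refine Fin.cases ?_ (fun i => ?_) i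
    · refine Fin.cases ?_ (fun j => ?_) j
      · simp [hy, hb, hkb, hwwC]
        field_simp
        ring
      · refine Fin.cases ?_ (fun j => ?_) j
        · simp [hy, hb, ha, bergman, Matrix.single]
        · simp [hy, hb, hz, Matrix.single, (Fin.succ_ne_zero _).symm]
    · refine Fin.cases ?_ (fun i => ?_) i
      · simp [hy, ha, bergman, Matrix.single]
      · simp [hy, hz, Matrix.single, (Fin.succ_ne_zero _).symm]
  have hfin := hE.det_nonneg
  rw [det_sub_single] at hfin
  have hsub2 : (kmat ℓ y).submatrix Fin.succ Fin.succ = kmat ℓ (Fin.cons a z : Fin (n+1) → Disc r) := by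
    ext i j; simp [hy, kmat]
  rw [hsub2] at hfin
  have hPd : P.det = d * q := by rw [← hdd]; field_simp
  rw [hPd]
  have := mul_nonneg hfin hq0
  rw [← sub_nonneg]
  convert this using 1
  push_cast
  ring

open Filter Topology in
lemma growth_contra (D : ℕ → ℝ) (C q : ℝ) (hC : 0 < C) (hq : 1 < q) (hD : ∀ n, 0 < D n)
    (hstep : ∀ n, q * D (n+1)^2 ≤ D (n+2) * D n)
    (hub : ∀ n, D n ≤ n.factorial * C ^ n) : False := by
  have hq0 : 0 < q := by linarith
  have hρ : ∀ n, q ^ n * (D 1 / D 0) ≤ D (n+1) / D n := by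
    intro n
    induction n with
    | zero => simp
    | succ k ih =>
      have h1 : q * (D (k+1) / D k) ≤ D (k+2) / D (k+1) := by
        have := hstep k
        have h0 := hD k
        have h1 := hD (k+1)
        rw [le_div_iff₀ h1, mul_assoc, div_mul_eq_mul_div, mul_div_assoc', div_le_iff₀ h0]
        nlinarith
      calc q ^ (k+1) * (D 1 / D 0) = q * (q ^ k * (D 1 / D 0)) := by ring
        _ ≤ q * (D (k+1) / D k) := by gcongr
        _ ≤ _ := h1
  have hρ0 : 0 < D 1 / D 0 := div_pos (hD 1) (hD 0)
  obtain ⟨N, hN⟩ : ∃ N : ℕ, ∀ n ≥ N, 2 * C * (n + 1) ≤ q ^ n * (D 1 / D 0) := by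
    have h1 : Tendsto (fun n : ℕ => (n : ℝ) ^ 1 / q ^ n) atTop (𝓝 0) :=
      tendsto_pow_const_div_const_pow_of_one_lt 1 hq
    have h2 : Tendsto (fun n : ℕ => (n : ℝ) ^ 0 / q ^ n) atTop (𝓝 0) :=
      tendsto_pow_const_div_const_pow_of_one_lt 0 hq
    have h3 := (h1.add h2).const_mul (2 * C)
    simp only [add_zero, mul_zero] at h3
    have h4 := (h3.eventually (gt_mem_nhds hρ0))
    obtain ⟨N, hN⟩ := eventually_atTop.mp h4
    refine ⟨N, fun n hn => ?_⟩
    have := (hN n hn).le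
    have hqn : 0 < q ^ n := pow_pos hq0 n
    rw [← add_div, mul_div_assoc', div_le_iff₀ hqn] at this
    simp only [pow_one, pow_zero] at this
    linarith
  have hk : ∀ k : ℕ, 2 ^ k * (D N / (N.factorial * C ^ N)) ≤ 1 := by
    intro k
    have hle : 2 ^ k * (D N / (N.factorial * C ^ N)) ≤ D (N+k) / ((N+k).factorial * C ^ (N+k)) := by
      induction k with
      | zero => simp
      | succ k ih =>
        have h1 := (hN (N+k) (by omega)).trans (hρ (N+k))
        have h0 := hD (N+k)
        rw [le_div_iff₀ h0] at h1
        have hf : (0:ℝ) < (N+k).factorial := by positivity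
        calc 2 ^ (k+1) * (D N / (N.factorial * C ^ N)) = 2 * (2 ^ k * (D N / (N.factorial * C ^ N))) := by ring
          _ ≤ 2 * (D (N+k) / ((N+k).factorial * C ^ (N+k))) := by gcongr
          _ ≤ _ := by
            rw [← add_assoc, Nat.factorial_succ, mul_div_assoc', div_le_div_iff₀ (by positivity) (by positivity)]
            push_cast
            push_cast at h1
            have h2 := mul_le_mul_of_nonneg_right h1 (show 0 ≤ ((N+k).factorial : ℝ) * C ^ (N+k) by positivity)
            calc _ = 2 * C * ((N:ℝ) + k + 1) * D (N+k) * ((N+k).factorial * C ^ (N+k)) := by ring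
              _ ≤ _ := h2
    refine hle.trans ?_
    rw [div_le_one (by positivity)]
    exact hub _
  have hpos : 0 < D N / (N.factorial * C ^ N) := by
    have := hD N
    positivity
  obtain ⟨k, hk'⟩ := pow_unbounded_of_one_lt (1 / (D N / (N.factorial * C ^ N))) (show (1:ℝ) < 2 by norm_num)
  rw [div_lt_iff₀ hpos] at hk'
  linarith [hk k]

lemma vdm_cons {n : ℕ} (a : ℝ) (z : Fin n → ℝ) :
    (vandermonde (Fin.cons a z : Fin (n+1) → ℝ)).det = (∏ i, (z i - a)) * (vandermonde z).det := by
  rw [det_vandermonde, det_vandermonde, Fin.prod_univ_succ]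
  simp

lemma vdm_cons_cons {n : ℕ} (a b : ℝ) (z : Fin n → ℝ) :
    (vandermonde (Fin.cons b (Fin.cons a z : Fin (n+1) → ℝ) : Fin (n+2) → ℝ)).det * (vandermonde z).det =
    (a - b) * ((vandermonde (Fin.cons b z : Fin (n+1) → ℝ)).det * (vandermonde (Fin.cons a z : Fin (n+1) → ℝ)).det) := by
  simp only [vdm_cons, Fin.prod_univ_succ, Fin.cons_zero, Fin.cons_succ]
  ring

def pt (r : ℝ) (hr : 0 < r) (s : ℝ) : Disc r :=
  if h : |s| < r then ⟨(s : ℂ), by simpa using h⟩ else ⟨0, by simpa using hr⟩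

lemma pt_coe {r : ℝ} (hr : 0 < r) {s : ℝ} (h : |s| < r) : ((pt r hr s : Disc r) : ℂ) = s := by
  simp [pt, h]

open Filter Topology in
lemma det_asymp {r : ℝ} (hr0 : 0 < r) (ℓc : ℕ → ℕ → ℂ)
    (habs : ∀ z w : Disc r, Summable fun p : ℕ × ℕ =>
      ‖ℓc p.1 p.2 * (z : ℂ) ^ p.1 * ((starRingEnd ℂ) (w : ℂ)) ^ p.2‖)
    {n : ℕ} (x : Fin n → ℝ) (hx : Function.Injective x) :
    Tendsto (fun t : ℝ => (kmat (fun z w : Disc r => serKer ℓc ↑z ↑w) (fun i => pt r hr0 (t * x i))).det /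
      (((vandermonde (fun i => t * x i)).det : ℝ) : ℂ)^2) (𝓝[>] 0)
      (𝓝 (Matrix.of fun i j : Fin n => ℓc ↑i ↑j).det) := by
  set V : Matrix (Fin n) (Fin n) ℂ := vandermonde (fun i => (x i : ℂ)) with hV
  have hVd : V.det ≠ 0 := by
    rw [hV, det_vandermonde_ne_zero_iff]
    exact fun i j h => hx (Complex.ofReal_injective h)
  set U := V⁻¹ with hU
  have hUV : U * V = 1 := Matrix.nonsing_inv_mul _ (isUnit_iff_ne_zero.mpr hVd)
  let c : Fin n → ℕ → ℂ := fun p a => ∑ i, U p i * (x i : ℂ) ^ a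
  have hc : ∀ p q : Fin n, c p q = if p = q then 1 else 0 := by
    intro p q
    have := congrFun (congrFun hUV p) q
    rw [Matrix.mul_apply, Matrix.one_apply] at this
    exact this
  set R : ℝ := 1 + ∑ i, |x i| with hR
  have hxR : ∀ i, |x i| ≤ R := by
    intro i
    have := Finset.single_le_sum (f := fun i => |x i|) (fun i _ => abs_nonneg _) (Finset.mem_univ i)
    linarith
  have hR0 : 0 < R := by
    have : 0 ≤ ∑ i, |x i| := Finset.sum_nonneg fun i _ => abs_nonneg _
    linarith
  let K : Fin n → ℝ := fun p => ∑ i, ‖U p i‖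
  have hcK : ∀ p a, ‖c p a‖ ≤ K p * R ^ a := by
    intro p a
    simp only [c, K]
    refine (norm_sum_le _ _).trans ?_
    rw [Finset.sum_mul]
    refine Finset.sum_le_sum fun i _ => ?_
    rw [norm_mul, norm_pow, Complex.norm_real, Real.norm_eq_abs]
    gcongr
    exact hxR i
  have hK0 : ∀ p, 0 ≤ K p := fun p => Finset.sum_nonneg fun i _ => norm_nonneg _
  set t0 : ℝ := r / (2 * R) with ht0
  have ht00 : 0 < t0 := by positivity
  have ht0R : t0 * R = r / 2 := by rw [ht0]; field_simp
  let e : Fin n → ℝ → ℕ → ℂ := fun p t a => c p a * ((t : ℂ) ^ a / (t : ℂ) ^ (p : ℕ))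
  have hev : ∀ᶠ t : ℝ in 𝓝[>] 0, 0 < t ∧ t < t0 :=
    Ioo_mem_nhdsGT ht00
  have he_bound : ∀ p (t : ℝ), 0 < t → t < t0 → ∀ a, ‖e p t a‖ ≤ K p / t0 ^ (p:ℕ) * (r/2) ^ a := by
    intro p t h0 h1 a
    have hnn : 0 ≤ K p / t0 ^ (p:ℕ) * (r/2) ^ a := by
      have := hK0 p
      positivity
    by_cases hap : a < p
    · have : c p a = 0 := by
        have := hc p ⟨a, hap.trans p.2⟩
        simp only at this
        rw [this, if_neg]
        intro h
        rw [h] at hap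
        simp at hap
      simp only [e, this, zero_mul, norm_zero]
      exact hnn
    · push Not at hap
      obtain ⟨k, rfl⟩ := Nat.exists_eq_add_of_le hap
      have hdiv : (t : ℂ) ^ ((p:ℕ) + k) / (t : ℂ) ^ (p : ℕ) = (t:ℂ) ^ k := by
        have : (t : ℂ) ≠ 0 := by exact_mod_cast h0.ne'
        rw [pow_add]; field_simp
      simp only [e]
      rw [hdiv, norm_mul, norm_pow, Complex.norm_real, Real.norm_eq_abs, abs_of_pos h0]
      calc ‖c p (p + k)‖ * t ^ k ≤ (K p * R ^ ((p:ℕ) + k)) * t0 ^ k := by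
            gcongr
            exact hcK p _
        _ = _ := by
            rw [← ht0R, mul_pow, pow_add]
            field_simp
            ring
  have he_lim : ∀ p a, Tendsto (fun t => e p t a) (𝓝[>] 0) (𝓝 (if (p:ℕ) = a then 1 else 0)) := by
    intro p a
    by_cases han : a < n
    · have h1 := hc p ⟨a, han⟩
      simp only [Fin.ext_iff] at h1
      by_cases h : (p : ℕ) = a
      · rw [if_pos h] at h1 ⊢
        refine tendsto_const_nhds.congr' ?_
        filter_upwards [hev] with t ht
        have : (t : ℂ) ≠ 0 := by exact_mod_cast ht.1.ne'
        simp only [e, h1, h]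
        field_simp
      · rw [if_neg h] at h1 ⊢
        simp [e, h1]
    · have hpa : (p : ℕ) < a := by omega
      rw [if_neg hpa.ne]
      obtain ⟨k, rfl⟩ := Nat.exists_eq_add_of_lt hpa
      have h2 : Tendsto (fun t : ℝ => c p (p + k + 1) * (t : ℂ) ^ (k+1)) (𝓝[>] 0) (𝓝 0) := by
        have : Continuous (fun t : ℝ => c p (p + k + 1) * (t : ℂ) ^ (k+1)) := by fun_prop
        have := this.tendsto 0
        simp only [Complex.ofReal_zero, ne_eq, Nat.add_eq_zero_iff, one_ne_zero, and_false,
          not_false_eq_true, zero_pow, mul_zero] at this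
        exact this.mono_left nhdsWithin_le_nhds
      refine h2.congr' ?_
      filter_upwards [hev] with t ht
      have : (t : ℂ) ≠ 0 := by exact_mod_cast ht.1.ne'
      simp only [e]
      congr 1
      rw [add_assoc, pow_add _ (p:ℕ)]
      field_simp
  let G : ℝ → Matrix (Fin n) (Fin n) ℂ := fun t => Matrix.of fun p q =>
    ∑' ab : ℕ × ℕ, ℓc ab.1 ab.2 * e p t ab.1 * e q t ab.2
  have hGlim : Tendsto G (𝓝[>] 0) (𝓝 (Matrix.of fun i j : Fin n => ℓc ↑i ↑j)) := by
    refine tendsto_pi_nhds.mpr fun p => tendsto_pi_nhds.mpr fun q => ?_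
    have hval : (Matrix.of fun i j : Fin n => ℓc ↑i ↑j) p q =
        ∑' ab : ℕ × ℕ, ℓc ab.1 ab.2 * (if (p:ℕ) = ab.1 then 1 else 0) * (if (q:ℕ) = ab.2 then 1 else 0) := by
      rw [tsum_eq_single ((p:ℕ), (q:ℕ))]
      · simp
      · rintro ⟨a, b⟩ hab
        by_cases h1 : (p:ℕ) = a
        · by_cases h2 : (q:ℕ) = b
          · exact absurd (by rw [h1, h2]) hab
          · simp [h2]
        · simp [h1]
    rw [hval]
    have hs := habs (pt r hr0 (r/2)) (pt r hr0 (r/2))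
    have hr2 : |r/2| < r := by rw [abs_of_pos (by positivity)]; linarith
    rw [pt_coe hr0 hr2] at hs
    refine tendsto_tsum_of_dominated_convergence
      (bound := fun ab : ℕ × ℕ => (K p / t0 ^ (p:ℕ) * (K q / t0 ^ (q:ℕ))) * ‖ℓc ab.1 ab.2 * ((r/2 : ℝ):ℂ) ^ ab.1 * ((starRingEnd ℂ) ((r/2 : ℝ):ℂ)) ^ ab.2‖)
      (hs.mul_left _) ?_ ?_
    · intro ab
      exact (tendsto_const_nhds.mul (he_lim p ab.1)).mul (he_lim q ab.2)
    · filter_upwards [hev] with t ht ab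
      have h1 := he_bound p t ht.1 ht.2 ab.1
      have h2 := he_bound q t ht.1 ht.2 ab.2
      have h3 : ‖ℓc ab.1 ab.2 * ((r/2 : ℝ):ℂ) ^ ab.1 * ((starRingEnd ℂ) ((r/2 : ℝ):ℂ)) ^ ab.2‖
          = ‖ℓc ab.1 ab.2‖ * (r/2) ^ ab.1 * (r/2) ^ ab.2 := by
        rw [norm_mul, norm_mul, norm_pow, norm_pow, RCLike.norm_conj, Complex.norm_real,
          Real.norm_eq_abs, abs_of_pos (by positivity : 0 < r/2)]
      have h4 : ‖ℓc ab.1 ab.2 * e p t ab.1 * e q t ab.2‖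
          = ‖ℓc ab.1 ab.2‖ * ‖e p t ab.1‖ * ‖e q t ab.2‖ := by
        generalize e p t ab.1 = y1
        generalize e q t ab.2 = y2
        rw [norm_mul, norm_mul]
      rw [h3, h4]
      calc ‖ℓc ab.1 ab.2‖ * ‖e p t ab.1‖ * ‖e q t ab.2‖
          ≤ ‖ℓc ab.1 ab.2‖ * (K p / t0 ^ (p:ℕ) * (r/2) ^ ab.1) * (K q / t0 ^ (q:ℕ) * (r/2) ^ ab.2) := by
            gcongr
        _ = _ := by ring
  have hdet : Tendsto (fun t => (G t).det) (𝓝[>] 0) (𝓝 (Matrix.of fun i j : Fin n => ℓc ↑i ↑j).det) :=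
    ((continuous_id.matrix_det).tendsto _).comp hGlim
  refine hdet.congr' ?_
  filter_upwards [hev] with t ht
  have htC : (t : ℂ) ≠ 0 := by exact_mod_cast ht.1.ne'
  let A : Matrix (Fin n) (Fin n) ℂ := Matrix.of fun p i => U p i / (t:ℂ) ^ (p:ℕ)
  let W : Matrix (Fin n) (Fin n) ℂ := vandermonde (fun i => ((t * x i : ℝ) : ℂ))
  have hAW : A * W = 1 := by
    ext p q
    have h1 := hc p q
    rw [Matrix.mul_apply, Matrix.one_apply]
    simp only [A, W, vandermonde_apply, Matrix.of_apply]
    have h2 : (∑ i, U p i / (t:ℂ) ^ (p:ℕ) * ((t * x i : ℝ) : ℂ) ^ (q:ℕ)) = c p q * ((t:ℂ) ^ (q:ℕ) / (t:ℂ)^(p:ℕ)) := by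
      simp only [c, Finset.sum_mul]
      refine Finset.sum_congr rfl fun i _ => ?_
      push_cast
      rw [mul_pow]
      field_simp
    rw [h2, h1]
    by_cases h : p = q
    · subst h
      simp [htC]
    · simp [h]
  have hWd : W.det = (((vandermonde (fun i => t * x i)).det : ℝ) : ℂ) := by
    simp only [W, det_vandermonde]
    push_cast
    rfl
  have hAd : A.det * W.det = 1 := by rw [← Matrix.det_mul, hAW, Matrix.det_one]
  set L := kmat (fun z w : Disc r => serKer ℓc ↑z ↑w) (fun i => pt r hr0 (t * x i)) with hL
  have hcoe : ∀ i, ((pt r hr0 (t * x i) : Disc r) : ℂ) = ((t * x i : ℝ) : ℂ) := by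
    intro i
    apply pt_coe
    rw [abs_mul, abs_of_pos ht.1]
    calc t * |x i| ≤ t0 * R := mul_le_mul ht.2.le (hxR i) (abs_nonneg _) ht00.le
      _ < r := by rw [ht0R]; linarith
  have hG : G t = A * L * Aᵀ := by
    ext p q
    have hsum : HasSum (fun ab : ℕ × ℕ => ∑ j, (∑ i, A p i * (ℓc ab.1 ab.2 * ((t * x i : ℝ) : ℂ) ^ ab.1 * ((t * x j : ℝ) : ℂ) ^ ab.2)) * A q j)
        ((A * L * Aᵀ) p q) := by
      simp only [Matrix.mul_apply, Matrix.transpose_apply]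
      refine hasSum_sum fun j _ => HasSum.mul_right _ (hasSum_sum fun i _ => HasSum.mul_left _ ?_)
      have h1 := (habs (pt r hr0 (t * x i)) (pt r hr0 (t * x j))).of_norm.hasSum
      rw [hcoe, hcoe, Complex.conj_ofReal] at h1
      simp only [hL, kmat, serKer, Matrix.of_apply]
      rw [hcoe, hcoe, Complex.conj_ofReal]
      exact h1
    rw [← hsum.tsum_eq]
    simp only [G, Matrix.of_apply]
    refine tsum_congr fun ab => ?_
    simp only [e, c, A, Matrix.of_apply, Finset.sum_mul, Finset.mul_sum]
    refine Finset.sum_congr rfl fun j _ => Finset.sum_congr rfl fun i _ => ?_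
    push_cast
    rw [mul_pow, mul_pow]
    field_simp
  show (G t).det = _
  rw [hG, Matrix.det_mul, Matrix.det_mul, Matrix.det_transpose, ← hWd]
  have hW0 : W.det ≠ 0 := right_ne_zero_of_mul_eq_one hAd
  rw [eq_div_iff (pow_ne_zero 2 hW0)]
  calc _ = L.det * (A.det * W.det)^2 := by ring
    _ = _ := by rw [hAd]; ring

open Filter Topology in
lemma det_step {r : ℝ} (hr0 : 0 < r) (hr1 : r ≤ 1)
    (ℓc : ℕ → ℕ → ℂ)
    (habs : ∀ z w : Disc r, Summable fun p : ℕ × ℕ =>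
      ‖ℓc p.1 p.2 * (z : ℂ) ^ p.1 * ((starRingEnd ℂ) (w : ℂ)) ^ p.2‖)
    (hpos : IsPosKernel fun z w : Disc r => serKer ℓc ↑z ↑w)
    (hCP : IsCompletePickPair (fun z w : Disc r => bergman ↑z ↑w)
      (fun z w : Disc r => serKer ℓc ↑z ↑w)) (n : ℕ)
    (hne : (Matrix.of fun i j : Fin n => ℓc ↑i ↑j).det ≠ 0) :
    0 ≤ (Matrix.of fun i j : Fin n => ℓc ↑i ↑j).det ∧
    2 * ((Matrix.of fun i j : Fin (n+1) => ℓc ↑i ↑j).det * (Matrix.of fun i j : Fin (n+1) => ℓc ↑i ↑j).det) ≤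
      (Matrix.of fun i j : Fin (n+2) => ℓc ↑i ↑j).det * (Matrix.of fun i j : Fin n => ℓc ↑i ↑j).det := by
  let z : Fin n → ℝ := fun i => (i : ℝ) + 1
  have hz : Function.Injective z := by
    intro i j h
    simp only [z, add_left_inj, Nat.cast_inj] at h
    exact Fin.ext h
  have hz0 : ∀ i, 0 < z i := fun i => by simp only [z]; positivity
  let za : Fin (n+1) → ℝ := Fin.cons 0 z
  let zb : Fin (n+1) → ℝ := Fin.cons (-1) z
  let zba : Fin (n+2) → ℝ := Fin.cons (-1) za
  have hza : Function.Injective za := by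
    refine Fin.cons_injective_iff.mpr ⟨?_, hz⟩
    rintro ⟨i, hi⟩
    exact (hz0 i).ne' hi
  have hzb : Function.Injective zb := by
    refine Fin.cons_injective_iff.mpr ⟨?_, hz⟩
    rintro ⟨i, hi⟩
    linarith [hz0 i]
  have hzba : Function.Injective zba := by
    refine Fin.cons_injective_iff.mpr ⟨?_, hza⟩
    rintro ⟨i, hi⟩
    revert hi
    refine Fin.cases ?_ (fun i => ?_) i
    · simp [za]
    · intro hi
      simp only [za, Fin.cons_succ] at hi
      linarith [hz0 i]
  have T0 := det_asymp hr0 ℓc habs z hz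
  have Ta := det_asymp hr0 ℓc habs za hza
  have Tb := det_asymp hr0 ℓc habs zb hzb
  have Tba := det_asymp hr0 ℓc habs zba hzba
  set ℓ : Disc r → Disc r → ℂ := fun z w : Disc r => serKer ℓc ↑z ↑w with hℓ
  have hsq : ∀ v : ℝ, (0:ℂ) ≤ (v:ℂ)^2 := by
    intro v
    rw [← Complex.ofReal_pow]
    exact Complex.zero_le_real.mpr (sq_nonneg v)
  refine ⟨ge_of_tendsto T0 (Eventually.of_forall fun t => div_nonneg (kmat_psd hpos _).det_nonneg (hsq _)), ?_⟩
  have hF : Tendsto (fun t : ℝ => ((2 - t^2 : ℝ) : ℂ)) (𝓝[>] 0) (𝓝 2) := by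
    have : Continuous (fun t : ℝ => ((2 - t^2 : ℝ) : ℂ)) := by fun_prop
    have := this.tendsto 0
    norm_num at this
    refine Tendsto.mono_left ?_ nhdsWithin_le_nhds
    simpa using this
  refine le_of_tendsto_of_tendsto (hF.mul (Tb.mul Ta)) (Tba.mul T0) ?_
  have hev : ∀ᶠ t : ℝ in 𝓝[>] 0, 0 < t ∧ t < r := Ioo_mem_nhdsGT hr0
  filter_upwards [hev, T0.eventually_ne hne] with t ht hnt
  have hd : (kmat ℓ (fun i => pt r hr0 (t * z i))).det ≠ 0 := fun h => hnt (by rw [h, zero_div])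
  have hI := det_ineq hr1 ℓ hpos hCP (pt r hr0 (t * 0)) (pt r hr0 (t * (-1)))
    (by rw [pt_coe hr0 (by simpa using hr0)]; simp) (fun i => pt r hr0 (t * z i)) hd
  have e1 : (Fin.cons (pt r hr0 (t * 0)) (fun i => pt r hr0 (t * z i)) : Fin (n+1) → Disc r)
      = fun i => pt r hr0 (t * za i) := by
    ext i; refine Fin.cases ?_ (fun i => ?_) i <;> simp [za]
  have e2 : (Fin.cons (pt r hr0 (t * (-1))) (fun i => pt r hr0 (t * z i)) : Fin (n+1) → Disc r)
      = fun i => pt r hr0 (t * zb i) := by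
    ext i; refine Fin.cases ?_ (fun i => ?_) i <;> simp [zb]
  have e3 : (Fin.cons (pt r hr0 (t * (-1))) (fun i => pt r hr0 (t * za i)) : Fin (n+2) → Disc r)
      = fun i => pt r hr0 (t * zba i) := by
    ext i; refine Fin.cases ?_ (fun i => ?_) i <;> simp [zba]
  rw [e1, e2, e3, pt_coe hr0 (by rw [abs_mul, abs_of_pos ht.1]; simpa using ht.2)] at hI
  have hn : ‖((t * (-1) : ℝ) : ℂ)‖^2 = t^2 := by
    rw [Complex.norm_real, Real.norm_eq_abs, sq_abs]; ring
  rw [hn] at hI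
  have hv := vdm_cons_cons (t * 0) (t * (-1)) (fun i => t * z i)
  have f1 : (Fin.cons (t * 0) (fun i => t * z i) : Fin (n+1) → ℝ) = fun i => t * za i := by
    ext i; refine Fin.cases ?_ (fun i => ?_) i <;> simp [za]
  have f2 : (Fin.cons (t * (-1)) (fun i => t * z i) : Fin (n+1) → ℝ) = fun i => t * zb i := by
    ext i; refine Fin.cases ?_ (fun i => ?_) i <;> simp [zb]
  have f3 : (Fin.cons (t * (-1)) (fun i => t * za i) : Fin (n+2) → ℝ) = fun i => t * zba i := by
    ext i; refine Fin.cases ?_ (fun i => ?_) i <;> simp [zba]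
  rw [f1, f2, f3] at hv
  have inj : ∀ {m : ℕ} (y : Fin m → ℝ), Function.Injective y → (vandermonde (fun i => t * y i)).det ≠ 0 := by
    intro m y hy
    rw [det_vandermonde_ne_zero_iff]
    exact fun i j h => hy (mul_left_cancel₀ ht.1.ne' h)
  have n0 := inj z hz
  have na := inj za hza
  have nb := inj zb hzb
  have nba := inj zba hzba
  set v0 := (vandermonde (fun i => t * z i)).det
  set va := (vandermonde (fun i => t * za i)).det
  set vb := (vandermonde (fun i => t * zb i)).det
  set vba := (vandermonde (fun i => t * zba i)).det
  set D0 := (kmat ℓ (fun i => pt r hr0 (t * z i))).det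
  set Da := (kmat ℓ (fun i => pt r hr0 (t * za i))).det
  set Db := (kmat ℓ (fun i => pt r hr0 (t * zb i))).det
  set Dba := (kmat ℓ (fun i => pt r hr0 (t * zba i))).det
  have hc : (0:ℂ) ≤ (((vba * v0)⁻¹ : ℝ) : ℂ)^2 := hsq _
  have hJ := mul_le_mul_of_nonneg_left hI hc
  have hv' : (vba : ℂ) * v0 = t * (vb * va) := by
    have : vba * v0 = t * (vb * va) := by rw [hv]; ring
    exact_mod_cast this
  have n0' : (v0 : ℂ) ≠ 0 := by exact_mod_cast n0
  have na' : (va : ℂ) ≠ 0 := by exact_mod_cast na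
  have nb' : (vb : ℂ) ≠ 0 := by exact_mod_cast nb
  have nba' : (vba : ℂ) ≠ 0 := by exact_mod_cast nba
  have nt : (t : ℂ) ≠ 0 := by exact_mod_cast ht.1.ne'
  convert hJ using 1
  · push_cast
    rw [hv']
    field_simp
    ring
  · push_cast
    field_simp

/-- If `ℓ` is a regular holomorphic positive kernel on `r𝔻` (with `0 < r ≤ 1`) such that
`(𝔟, ℓ)` is a complete Pick pair on `r𝔻`, then `r ≤ 1/√2`. -/
theorem bergman_max_disc (r : ℝ) (hr0 : 0 < r) (hr1 : r ≤ 1)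
    (ℓc : ℕ → ℕ → ℂ)
    (habs : ∀ z w : Disc r, Summable fun p : ℕ × ℕ =>
      ‖ℓc p.1 p.2 * (z : ℂ) ^ p.1 * ((starRingEnd ℂ) (w : ℂ)) ^ p.2‖)
    (hpos : IsPosKernel fun z w : Disc r => serKer ℓc ↑z ↑w)
    (hreg1 : ∃ ε > (0 : ℝ), ∀ (n : ℕ) (z : Fin n → ℂ), Function.Injective z →
      (∀ i, ‖z i‖ < ε) →
      LinearIndependent ℂ (fun i : Fin n => fun x : Disc r => serKer ℓc ↑x (z i)))
    (hreg2 : ∀ n : ℕ, (Matrix.of fun i j : Fin (n + 1) => ℓc ↑i ↑j).det ≠ 0)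
    (hCP : IsCompletePickPair (fun z w : Disc r => bergman ↑z ↑w)
      (fun z w : Disc r => serKer ℓc ↑z ↑w)) :
    r ≤ 1 / Real.sqrt 2 := by
  by_contra hcon
  push Not at hcon
  obtain ⟨s, hs1, hs2⟩ := exists_between hcon
  have hs0 : 0 < s := lt_trans (by positivity) hs1
  have hq : 1 < 2 * s ^ 2 := by
    have h2 : (0:ℝ) < Real.sqrt 2 := by positivity
    rw [div_lt_iff₀ h2] at hs1
    have h3 : Real.sqrt 2 ^ 2 = 2 := Real.sq_sqrt (by norm_num)
    have h4 : 1 < (s * Real.sqrt 2) ^ 2 := by nlinarith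
    rw [mul_pow, h3] at h4
    linarith
  have hne : ∀ n : ℕ, (Matrix.of fun i j : Fin n => ℓc ↑i ↑j).det ≠ 0 := by
    intro n
    cases n with
    | zero => simp
    | succ n => exact hreg2 n
  have hstep := fun n => det_step hr0 hr1 ℓc habs hpos hCP n (hne n)
  have hreal : ∀ n : ℕ, ∃ d : ℝ, 0 < d ∧ (Matrix.of fun i j : Fin n => ℓc ↑i ↑j).det = (d : ℂ) := by
    intro n
    have h1 := Complex.le_def.mp (hstep n).1
    have h2 : (Matrix.of fun i j : Fin n => ℓc ↑i ↑j).det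
        = (((Matrix.of fun i j : Fin n => ℓc ↑i ↑j).det.re : ℝ) : ℂ) := by
      apply Complex.ext
      · simp
      · simpa using h1.2.symm
    refine ⟨_, lt_of_le_of_ne h1.1 ?_, h2⟩
    intro h
    apply hne n
    rw [h2, ← h]; simp
  choose d hd0 hdd using hreal
  have hsum := habs ⟨(s : ℂ), by simpa [abs_of_pos hs0] using hs2⟩
    ⟨(s : ℂ), by simpa [abs_of_pos hs0] using hs2⟩
  simp only [Complex.conj_ofReal] at hsum
  set C0 : ℝ := ∑' p : ℕ × ℕ, ‖ℓc p.1 p.2 * (s : ℂ) ^ p.1 * (s : ℂ) ^ p.2‖ with hC0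
  have hC00 : 0 ≤ C0 := tsum_nonneg fun _ => norm_nonneg _
  have hterm : ∀ i j : ℕ, ‖ℓc i j * (s : ℂ) ^ i * (s : ℂ) ^ j‖ ≤ C0 + 1 := by
    intro i j
    have := hsum.le_tsum (i, j) (fun _ _ => norm_nonneg _)
    simp only at this
    linarith
  refine growth_contra (fun n => d n * (∏ i : Fin n, s ^ (i : ℕ)) ^ 2) (C0 + 1) (2 * s ^ 2)
    (by linarith) hq (fun n => ?_) (fun n => ?_) (fun n => ?_)
  · have := hd0 n
    positivity
  · have h := (hstep n).2
    rw [hdd, hdd, hdd] at h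
    have h' : 2 * (d (n+1) * d (n+1)) ≤ d (n+2) * d n := by exact_mod_cast h
    simp only [Fin.prod_univ_castSucc, Fin.val_castSucc, Fin.val_last]
    set p := ∏ i : Fin n, s ^ (i : ℕ)
    have h2 := mul_le_mul_of_nonneg_right h' (show 0 ≤ (p ^ 2 * s ^ (2 * n + 1)) ^ 2 by positivity)
    calc _ = 2 * (d (n+1) * d (n+1)) * (p ^ 2 * s ^ (2 * n + 1)) ^ 2 := by ring
      _ ≤ _ := h2
      _ = _ := by ring
  · set p := ∏ i : Fin n, s ^ (i : ℕ) with hp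
    have h1 : (Matrix.of fun i j : Fin n => (s : ℂ) ^ (j : ℕ) *
        (Matrix.of fun i j : Fin n => (s : ℂ) ^ (i : ℕ) *
          (Matrix.of fun i j : Fin n => ℓc ↑i ↑j) i j) i j).det = ((d n * p ^ 2 : ℝ) : ℂ) := by
      rw [Matrix.det_mul_row, Matrix.det_mul_column, hdd, hp]
      push_cast
      ring
    have h2 := Matrix.det_le (abv := (IsAbsoluteValue.toAbsoluteValue (norm : ℂ → ℝ))) (x := C0 + 1)
      (A := (Matrix.of fun i j : Fin n => (s : ℂ) ^ (j : ℕ) *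
        (Matrix.of fun i j : Fin n => (s : ℂ) ^ (i : ℕ) *
          (Matrix.of fun i j : Fin n => ℓc ↑i ↑j) i j) i j)) (by
        intro i j
        have := hterm i j
        simp only [Matrix.of_apply]
        rw [IsAbsoluteValue.toAbsoluteValue_apply]
        refine le_trans (le_of_eq ?_) this
        congr 1
        ring)
    rw [h1, IsAbsoluteValue.toAbsoluteValue_apply, Complex.norm_real, Real.norm_eq_abs] at h2
    refine (le_abs_self _).trans (h2.trans (le_of_eq ?_))
    simp
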